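/- arXiv:2110.15757 — 9 statements merged into one kernel-verified Lean document; each statement's English description precedes it below -/
import Mathlib

section
/- Let R = V_△ ∪ ⋃_{s∈S'}(A_s ∪ B_s ∪ {x_s}) ∪ ⋃_{s∈S∖S'} C_s for a subset S' ⊆ S. Then N_G(R) = U ∪ {a} ∪ {z_s : s ∈ S} ∪ {y_s : s ∈ S ∖ S'} ∪ ⋃_{s∈S'} A_s^□. -/
/-- The set of vertices outside `R` having at least one neighbour in `R`. -/
def nbhd {V : Type*} (G : SimpleGraph V) (R : Set V) : Set V :=
  {v | v ∉ R ∧ ∃ u ∈ R, G.Adj u v}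

/-- The number of neighbours of `v` lying in `R`. -/
noncomputable def degIn {V : Type*} (G : SimpleGraph V) (R : Set V) (v : V) : ℕ :=
  (G.neighborSet v ∩ R).ncard

/-- `R` is an offensive alliance: nonempty, and every vertex of `N(R)` has at least
one more neighbour inside `R` than outside `R`. -/
def IsOffensiveAlliance {V : Type*} (G : SimpleGraph V) (R : Set V) : Prop :=
  R.Nonempty ∧ ∀ v ∈ nbhd G R, degIn G Rᶜ v + 1 ≤ degIn G R v

/-- `R` is a strong offensive alliance. -/
def IsStrongOffensiveAlliance {V : Type*} (G : SimpleGraph V) (R : Set V) : Prop :=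
  R.Nonempty ∧ ∀ v ∈ nbhd G R, degIn G Rᶜ v + 2 ≤ degIn G R v

/-- `max(s)` for the vector `s = vec i`. -/
def M {k n : ℕ} (vec : Fin n → Fin k → ℕ) (i : Fin n) : ℕ :=
  Finset.univ.sup (vec i)

/-- Vertices of the MRSS gadget graph. -/
inductive MV (k n : ℕ) (vec : Fin n → Fin k → ℕ) (t : Fin k → ℕ) : Type where
  | u (j : Fin k)
  | a
  | aA (p : Fin 4)
  | aS (i : Fin n) (p : Fin (M vec i + 1))
  | bS (i : Fin n) (p : Fin (M vec i + 1))
  | aSq (i : Fin n) (p : Fin (M vec i + 1))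
  | bSq (i : Fin n) (p : Fin (M vec i + 1))
  | cS (i : Fin n) (p : Fin (2 * M vec i + 2))
  | zS (i : Fin n) (p : Fin 6)
  | xS (i : Fin n)
  | yS (i : Fin n)
  | zv (i : Fin n)
  | uSq (j : Fin k) (p : Fin (∑ i, vec i j))
  | uTri (j : Fin k) (p : Fin (2 * (∑ i, vec i j) - 2 * t j + 2))

/-- One direction of each edge of the MRSS gadget graph; `sel i j` is the (arbitrarily
chosen) set of indices of the `vec i j` vertices of `A_{s_i}` adjacent to `u_j`. -/
def mrel {k n : ℕ} (vec : Fin n → Fin k → ℕ) (t : Fin k → ℕ)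
    (sel : (i : Fin n) → (j : Fin k) → Finset (Fin (M vec i + 1))) :
    MV k n vec t → MV k n vec t → Prop
  | MV.aSq i p, MV.bSq i' q => i = i' ∧ p.val = q.val
  | MV.aSq i p, MV.aS i' q => i = i' ∧ p.val = q.val
  | MV.aSq i p, MV.bS i' q => i = i' ∧ p.val = q.val
  | MV.xS i, MV.aSq i' _ => i = i'
  | MV.zv i, MV.zS i' _ => i = i'
  | MV.xS i, MV.zv i' => i = i'
  | MV.zv i, MV.yS i' => i = i'
  | MV.yS i, MV.cS i' _ => i = i'
  | MV.a, MV.aA _ => True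
  | MV.a, MV.aS _ _ => True
  | MV.a, MV.bS _ _ => True
  | MV.a, MV.cS _ _ => True
  | MV.u j, MV.aS i p => p ∈ sel i j
  | MV.u j, MV.uSq j' _ => j = j'
  | MV.u j, MV.uTri j' _ => j = j'
  | _, _ => False

/-- The MRSS gadget graph `G`. -/
def mgraph {k n : ℕ} (vec : Fin n → Fin k → ℕ) (t : Fin k → ℕ)
    (sel : (i : Fin n) → (j : Fin k) → Finset (Fin (M vec i + 1))) :
    SimpleGraph (MV k n vec t) :=
  SimpleGraph.fromRel (mrel vec t sel)

/-- The set `U = {u_1, …, u_k}`. -/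
def Uset {k n : ℕ} (vec : Fin n → Fin k → ℕ) (t : Fin k → ℕ) : Set (MV k n vec t) :=
  {v | ∃ j, v = MV.u j}

/-- The set `A_s` for `s = vec i`. -/
def Aset {k n : ℕ} (vec : Fin n → Fin k → ℕ) (t : Fin k → ℕ) (i : Fin n) :
    Set (MV k n vec t) := {v | ∃ p, v = MV.aS i p}

/-- The set `B_s` for `s = vec i`. -/
def Bset {k n : ℕ} (vec : Fin n → Fin k → ℕ) (t : Fin k → ℕ) (i : Fin n) :
    Set (MV k n vec t) := {v | ∃ p, v = MV.bS i p}

/-- The set `A_s^□` for `s = vec i`. -/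
def AsqSet {k n : ℕ} (vec : Fin n → Fin k → ℕ) (t : Fin k → ℕ) (i : Fin n) :
    Set (MV k n vec t) := {v | ∃ p, v = MV.aSq i p}

/-- The set `C_s` for `s = vec i`. -/
def Cset {k n : ℕ} (vec : Fin n → Fin k → ℕ) (t : Fin k → ℕ) (i : Fin n) :
    Set (MV k n vec t) := {v | ∃ p, v = MV.cS i p}

/-- The set `V_△` of necessary vertices. -/
def Vtri {k n : ℕ} (vec : Fin n → Fin k → ℕ) (t : Fin k → ℕ) : Set (MV k n vec t) :=
  {v | (∃ j p, v = MV.uTri j p) ∨ (∃ p : Fin 4, p ≠ 3 ∧ v = MV.aA p) ∨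
    (∃ i, ∃ p : Fin 6, p ≠ 5 ∧ v = MV.zS i p)}

/-- The set `V_□` of forbidden vertices. -/
def Vsq {k n : ℕ} (vec : Fin n → Fin k → ℕ) (t : Fin k → ℕ) : Set (MV k n vec t) :=
  {v | (∃ j, v = MV.u j) ∨ v = MV.a ∨ v = MV.aA 3 ∨ (∃ j p, v = MV.uSq j p) ∨
    (∃ i p, v = MV.aSq i p) ∨ (∃ i p, v = MV.bSq i p) ∨ (∃ i, v = MV.zv i) ∨
    (∃ i, v = MV.zS i 5)}

/-- The budget `r`. -/
def rval {k n : ℕ} (vec : Fin n → Fin k → ℕ) (t : Fin k → ℕ) (k' : ℕ) : ℕ :=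
  (∑ j : Fin k, 2 * ((∑ i, vec i j) - t j + 1)) + (∑ i : Fin n, 2 * (M vec i + 1)) +
    5 * n + 3 + k'

/-- The candidate solution `R = V_△ ∪ ⋃_{s ∈ S'} (A_s ∪ B_s ∪ {x_s}) ∪ ⋃_{s ∈ S∖S'} C_s`. -/
def Rsol {k n : ℕ} (vec : Fin n → Fin k → ℕ) (t : Fin k → ℕ) (S' : Finset (Fin n)) :
    Set (MV k n vec t) :=
  Vtri vec t ∪ (⋃ i ∈ S', (Aset vec t i ∪ Bset vec t i ∪ {MV.xS i})) ∪
    (⋃ i ∈ S'ᶜ, Cset vec t i)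

theorem stmt1 {k n : ℕ} (hk : 1 ≤ k) (hn : 1 ≤ n) (k' : ℕ)
    (vec : Fin n → Fin k → ℕ) (t : Fin k → ℕ)
    (ht : ∀ j, t j ≤ ∑ i, vec i j)
    (sel : (i : Fin n) → (j : Fin k) → Finset (Fin (M vec i + 1)))
    (hsel : ∀ i j, (sel i j).card = vec i j)
    (S' : Finset (Fin n)) :
    nbhd (mgraph vec t sel) (Rsol vec t S') =
      Uset vec t ∪ {MV.a} ∪ {v | ∃ i, v = MV.zv i} ∪
        {v | ∃ i ∉ S', v = MV.yS i} ∪ (⋃ i ∈ S', AsqSet vec t i) := by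
  ext v
  have adj_of_mrel : ∀ {x y : MV k n vec t}, x ≠ y → mrel vec t sel x y ∨ mrel vec t sel y x →
      (mgraph vec t sel).Adj x y := fun hne h => (SimpleGraph.fromRel_adj _ _ _).2 ⟨hne, h⟩
  constructor
  · rintro ⟨hv, w, hw, hadj⟩
    have h := ((SimpleGraph.fromRel_adj _ _ _).1 hadj).2
    clear hadj
    simp only [Rsol, Vtri, Aset, Bset, Cset, Set.mem_union, Set.mem_iUnion, Set.mem_ofPred_eq,
      Set.mem_singleton_iff, Finset.mem_compl, exists_prop] at hw
    simp only [Uset, AsqSet, Set.mem_union, Set.mem_iUnion, Set.mem_ofPred_eq,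
      Set.mem_singleton_iff, exists_prop]
    rcases hw with ((⟨j, p, rfl⟩ | ⟨p, -, rfl⟩ | ⟨i, p, -, rfl⟩) |
      ⟨i, hi, (⟨p, rfl⟩ | ⟨p, rfl⟩) | rfl⟩) | ⟨i, hi, p, rfl⟩ <;>
    cases v <;> simp only [mrel, or_false, false_or, or_self] at h <;> clear hv <;> simp_all
    · obtain ⟨rfl, -⟩ := h
      exact ⟨_, HEq.rfl⟩
    · obtain ⟨rfl, -⟩ := h
      exact ⟨_, HEq.rfl⟩
  · rintro ((((⟨j, rfl⟩ | rfl) | ⟨i, rfl⟩) | ⟨i, hi, rfl⟩) | h)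
    · refine ⟨by simp [Rsol, Vtri, Aset, Bset, Cset], MV.uTri j ⟨0, by omega⟩, ?_, ?_⟩
      · simp [Rsol, Vtri]
      · exact adj_of_mrel (by simp) (Or.inr rfl)
    · refine ⟨by simp [Rsol, Vtri, Aset, Bset, Cset], MV.aA 0, ?_, ?_⟩
      · simp [Rsol, Vtri]
      · exact adj_of_mrel (by simp) (Or.inr trivial)
    · refine ⟨by simp [Rsol, Vtri, Aset, Bset, Cset], MV.zS i 0, ?_, ?_⟩
      · simp [Rsol, Vtri]
      · exact adj_of_mrel (by simp) (Or.inr rfl)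
    · refine ⟨by simp [Rsol, Vtri, Aset, Bset, Cset], MV.cS i ⟨0, by omega⟩, ?_, ?_⟩
      · simp [Rsol, Cset, hi]
      · exact adj_of_mrel (by simp) (Or.inr rfl)
    · simp only [Set.mem_iUnion] at h
      obtain ⟨i, hi, p, rfl⟩ := h
      refine ⟨by simp [Rsol, Vtri, Aset, Bset, Cset], MV.xS i, ?_, ?_⟩
      · simp [Rsol, Vtri, Aset, Bset, Cset, hi]
      · exact adj_of_mrel (by simp) (Or.inl rfl)
end

section
/- Let R be any strong offensive alliance of G with R ∩ V_□ = ∅, and let s ∈ S. If R contains at least one vertex of A_s ∪ B_s ∪ {x_s}, then A_s ∪ B_s ∪ {x_s} ⊆ R. -/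
/-- The neighbours of a vertex of `A_s^□`. -/
theorem neighborSet_aSq {k n : ℕ} (vec : Fin n → Fin k → ℕ) (t : Fin k → ℕ)
    (sel : (i : Fin n) → (j : Fin k) → Finset (Fin (M vec i + 1)))
    (i : Fin n) (p : Fin (M vec i + 1)) :
    (mgraph vec t sel).neighborSet (MV.aSq i p) =
      {MV.bSq i p, MV.aS i p, MV.bS i p, MV.xS i} := by
  ext w
  simp only [SimpleGraph.mem_neighborSet, mgraph, SimpleGraph.fromRel_adj,
    Set.mem_insert_iff, Set.mem_singleton_iff]
  have index_eq {i' : Fin n} {q : Fin (M vec i' + 1)} :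
      (i = i' ∧ p.val = q.val) ↔ (i' = i ∧ q ≍ p) := by
    constructor
    · rintro ⟨rfl, h⟩
      exact ⟨rfl, heq_of_eq (Fin.ext h.symm)⟩
    · rintro ⟨rfl, h⟩
      exact ⟨rfl, congrArg Fin.val (eq_of_heq h).symm⟩
  cases w <;> simp [mrel, index_eq]

/-- If a strong offensive alliance avoiding the forbidden vertices meets the neighbourhood of a
vertex of `A_s^□`, then it contains all three non-forbidden neighbours of that vertex. -/
theorem subset_of_adj_aSq {k n : ℕ} {vec : Fin n → Fin k → ℕ} {t : Fin k → ℕ}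
    {sel : (i : Fin n) → (j : Fin k) → Finset (Fin (M vec i + 1))}
    {R : Set (MV k n vec t)} (hR : IsStrongOffensiveAlliance (mgraph vec t sel) R)
    (hRsq : R ∩ Vsq vec t = ∅) {i : Fin n} {p : Fin (M vec i + 1)} {w : MV k n vec t}
    (hw : w ∈ R) (hadj : (mgraph vec t sel).Adj w (MV.aSq i p)) :
    {MV.aS i p, MV.bS i p, MV.xS i} ⊆ R := by
  have forbidden : ∀ v ∈ Vsq vec t, v ∉ R := fun v hv hvR =>
    (Set.eq_empty_iff_forall_notMem.mp hRsq v) ⟨hvR, hv⟩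
  have ha : MV.aSq i p ∉ R := forbidden _ (by simp [Vsq])
  have hb : MV.bSq i p ∉ R := forbidden _ (by simp [Vsq])
  have hdeg := hR.2 _ ⟨ha, w, hw, hadj⟩
  unfold degIn at hdeg
  rw [neighborSet_aSq] at hdeg
  have hout : 0 < (({MV.bSq i p, MV.aS i p, MV.bS i p, MV.xS i} : Set (MV k n vec t)) ∩
      Rᶜ).ncard :=
    (Set.ncard_pos ((Set.toFinite _).inter_of_left _)).mpr ⟨MV.bSq i p, by simp, hb⟩
  have hsub : ({MV.bSq i p, MV.aS i p, MV.bS i p, MV.xS i} : Set (MV k n vec t)) ∩ R ⊆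
      {MV.aS i p, MV.bS i p, MV.xS i} := by
    rintro v ⟨rfl | hv, hvR⟩
    · exact absurd hvR hb
    · exact hv
  have hcard : ({MV.aS i p, MV.bS i p, MV.xS i} : Set (MV k n vec t)).ncard ≤ 3 := by
    refine (Set.ncard_insert_le _ _).trans ?_
    have := Set.ncard_insert_le (MV.bS i p : MV k n vec t) {MV.xS i}
    rw [Set.ncard_singleton] at this
    omega
  rw [← Set.eq_of_subset_of_ncard_le hsub (by omega) (Set.toFinite _)]
  exact Set.inter_subset_right

theorem stmt2 {k n : ℕ} (hk : 1 ≤ k) (hn : 1 ≤ n) (k' : ℕ)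
    (vec : Fin n → Fin k → ℕ) (t : Fin k → ℕ)
    (ht : ∀ j, t j ≤ ∑ i, vec i j)
    (sel : (i : Fin n) → (j : Fin k) → Finset (Fin (M vec i + 1)))
    (hsel : ∀ i j, (sel i j).card = vec i j)
    (R : Set (MV k n vec t))
    (hR : IsStrongOffensiveAlliance (mgraph vec t sel) R)
    (hRsq : R ∩ Vsq vec t = ∅)
    (i : Fin n)
    (hmeet : (R ∩ (Aset vec t i ∪ Bset vec t i ∪ {MV.xS i})).Nonempty) :
    Aset vec t i ∪ Bset vec t i ∪ {MV.xS i} ⊆ R := by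
  have key : ∀ (p : Fin (M vec i + 1)) (w : MV k n vec t), w ∈ R →
      w ∈ ({MV.bSq i p, MV.aS i p, MV.bS i p, MV.xS i} : Set (MV k n vec t)) →
      {MV.aS i p, MV.bS i p, MV.xS i} ⊆ R := by
    intro p w hw hmem
    rw [← neighborSet_aSq vec t sel] at hmem
    exact subset_of_adj_aSq hR hRsq hw hmem.symm
  have hx : MV.xS i ∈ R := by
    obtain ⟨w, hw, (⟨p, rfl⟩ | ⟨p, rfl⟩) | rfl⟩ := hmeet
    · exact key p _ hw (by simp) (by simp)
    · exact key p _ hw (by simp) (by simp)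
    · exact hw
  rintro v ((⟨p, rfl⟩ | ⟨p, rfl⟩) | rfl)
  · exact key p _ hx (by simp) (by simp)
  · exact key p _ hx (by simp) (by simp)
  · exact hx
end

section
/- If G has a strong offensive alliance R with 1 ≤ |R| ≤ r, V_△ ⊆ R, and R ∩ V_□ = ∅, then there exists a subset S' ⊆ S with |S'| ≤ k' such that Σ_{s∈S'} s(i) ≥ t(i) for every 1 ≤ i ≤ k. -/
theorem Finset.card_le_ncard_of_injOn {α β : Type*} [Finite β] {s : Finset α} {T : Set β}
    (f : α → β) (hf : Set.InjOn f s) (hT : ∀ x ∈ s, f x ∈ T) : s.card ≤ T.ncard := by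
  rw [← Set.ncard_coe_finset, ← hf.ncard_image]
  exact Set.ncard_le_ncard (by rintro _ ⟨x, hx, rfl⟩; exact hT x hx) (Set.toFinite T)

theorem Set.ncard_le_card_of_forall_exists {α β : Type*} {s : Finset α} {T : Set β}
    (f : α → β) (hT : ∀ y ∈ T, ∃ x ∈ s, f x = y) : T.ncard ≤ s.card := by
  rw [← Set.ncard_coe_finset]
  refine (Set.ncard_le_ncard (t := f '' s) ?_ (s.finite_toSet.image f)).trans
    (Set.ncard_image_le s.finite_toSet)
  intro y hy
  obtain ⟨x, hx, rfl⟩ := hT y hy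
  exact ⟨x, hx, rfl⟩

section Gadget

variable {k n : ℕ} {vec : Fin n → Fin k → ℕ} {t : Fin k → ℕ}
  {sel : (i : Fin n) → (j : Fin k) → Finset (Fin (M vec i + 1))} {R : Set (MV k n vec t)}

instance MV.instFinite : Finite (MV k n vec t) := by
  rw [← Set.finite_univ_iff]
  refine Set.Finite.subset (s := Set.range (MV.u (n := n) (vec := vec) (t := t)) ∪ {MV.a} ∪
    Set.range MV.aA ∪
    Set.range (fun x : Σ i, Fin (M vec i + 1) => MV.aS x.1 x.2) ∪
    Set.range (fun x : Σ i, Fin (M vec i + 1) => MV.bS x.1 x.2) ∪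
    Set.range (fun x : Σ i, Fin (M vec i + 1) => MV.aSq x.1 x.2) ∪
    Set.range (fun x : Σ i, Fin (M vec i + 1) => MV.bSq x.1 x.2) ∪
    Set.range (fun x : Σ i, Fin (2 * M vec i + 2) => MV.cS x.1 x.2) ∪
    Set.range (fun x : Fin n × Fin 6 => MV.zS x.1 x.2) ∪
    Set.range MV.xS ∪ Set.range MV.yS ∪ Set.range MV.zv ∪
    Set.range (fun x : Σ j, Fin (∑ i, vec i j) => MV.uSq x.1 x.2) ∪
    Set.range (fun x : Σ j, Fin (2 * (∑ i, vec i j) - 2 * t j + 2) => MV.uTri x.1 x.2))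
    (by simp only [Set.finite_union, Set.finite_range, Set.finite_singleton, and_self]) ?_
  intro v _
  cases v <;> simp

/-- The vertices of `A_s ∪ B_s ∪ C_s`, over all `s`. -/
def MV.abc : (Σ i, (Fin (M vec i + 1) ⊕ Fin (M vec i + 1)) ⊕ Fin (2 * M vec i + 2)) →
    MV k n vec t
  | ⟨i, .inl (.inl p)⟩ => MV.aS i p
  | ⟨i, .inl (.inr p)⟩ => MV.bS i p
  | ⟨i, .inr p⟩ => MV.cS i p

/-- The vertices of `V_△`, indexed with the forbidden vertices `a^□` and `z^{□s}` included. -/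
def MV.tri : (Σ j, Fin (2 * (∑ i, vec i j) - 2 * t j + 2)) ⊕ (Fin 4 ⊕ Fin n × Fin 6) →
    MV k n vec t
  | .inl ⟨j, p⟩ => MV.uTri j p
  | .inr (.inl p) => MV.aA p
  | .inr (.inr (i, p)) => MV.zS i p

theorem le_card_filter_sel (hsel : ∀ i j, (sel i j).card = vec i j)
    (ht : ∀ j, t j ≤ ∑ i, vec i j) (hR : IsStrongOffensiveAlliance (mgraph vec t sel) R)
    (htri : ∀ j p, MV.uTri j p ∈ R) (hu : ∀ j, MV.u j ∉ R) (huSq : ∀ j p, MV.uSq j p ∉ R)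
    [DecidablePred (· ∈ R)] (j : Fin k) :
    t j ≤ ((Finset.univ.sigma fun i => sel i j).filter fun x => MV.aS x.1 x.2 ∈ R).card := by
  have hdeg := hR.2 (MV.u j) ⟨hu j, MV.uTri j ⟨0, by omega⟩, htri _ _, by
    simp [mgraph, SimpleGraph.fromRel_adj, mrel]⟩
  set F := Finset.univ.sigma fun i => sel i j with hF
  have hcard : F.card = ∑ i, vec i j := by simp [hF, Finset.card_sigma, hsel]
  have hsplit := Finset.card_filter_add_card_filter_not (s := F) fun x => MV.aS x.1 x.2 ∈ R
  have hin : degIn (mgraph vec t sel) R (MV.u j) ≤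
      ((F.filter fun x => MV.aS x.1 x.2 ∈ R).disjSum
        (Finset.univ : Finset (Fin (2 * (∑ i, vec i j) - 2 * t j + 2)))).card := by
    refine Set.ncard_le_card_of_forall_exists
      (Sum.elim (fun x => MV.aS x.1 x.2) fun p => MV.uTri j p) ?_
    rintro v ⟨hv, hvR⟩
    rw [SimpleGraph.mem_neighborSet, mgraph, SimpleGraph.fromRel_adj] at hv
    cases v with
    | aS i p => exact ⟨.inl ⟨i, p⟩, by simpa [mrel, hF, hvR] using hv, rfl⟩
    | uTri j' p =>
      obtain rfl : j = j' := by simpa [mrel] using hv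
      exact ⟨.inr p, by simp, rfl⟩
    | uSq j' p => exact (huSq _ _ hvR).elim
    | _ => simp [mrel] at hv
  have hout : ((F.filter fun x => MV.aS x.1 x.2 ∉ R).disjSum
      (Finset.univ : Finset (Fin (∑ i, vec i j)))).card ≤
        degIn (mgraph vec t sel) Rᶜ (MV.u j) := by
    refine Finset.card_le_ncard_of_injOn
      (Sum.elim (fun x => MV.aS x.1 x.2) fun p => MV.uSq j p) (Function.Injective.injOn ?_) ?_
    · refine Function.Injective.sumElim ?_ (fun _ _ h => by simpa using h) (by simp)
      rintro ⟨i, p⟩ ⟨i', p'⟩ h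
      simpa using h
    · rintro (⟨i, p⟩ | p) h
      · simpa [mgraph, SimpleGraph.fromRel_adj, mrel, hF] using h
      · simpa [mgraph, SimpleGraph.fromRel_adj, mrel] using huSq j p
  simp only [Finset.card_disjSum, Finset.card_univ, Fintype.card_fin] at hin hout
  have := ht j
  omega

theorem xS_mem_of_aS_mem (hR : IsStrongOffensiveAlliance (mgraph vec t sel) R)
    (haSq : ∀ i p, MV.aSq i p ∉ R) (hbSq : ∀ i p, MV.bSq i p ∉ R) {i : Fin n}
    {p : Fin (M vec i + 1)} (hp : MV.aS i p ∈ R) : MV.xS i ∈ R := by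
  by_contra hx
  have hdeg := hR.2 (MV.aSq i p) ⟨haSq i p, MV.aS i p, hp, by
    simp [mgraph, SimpleGraph.fromRel_adj, mrel]⟩
  have hin : degIn (mgraph vec t sel) R (MV.aSq i p) ≤ (Finset.univ : Finset Bool).card := by
    refine Set.ncard_le_card_of_forall_exists
      (fun b => if b then MV.aS i p else MV.bS i p) ?_
    rintro v ⟨hv, hvR⟩
    rw [SimpleGraph.mem_neighborSet, mgraph, SimpleGraph.fromRel_adj] at hv
    cases v with
    | aS i' q =>
      obtain ⟨rfl, h⟩ : i = i' ∧ p.val = q.val := by simpa [mrel] using hv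
      obtain rfl := Fin.ext h
      exact ⟨true, by simp⟩
    | bS i' q =>
      obtain ⟨rfl, h⟩ : i = i' ∧ p.val = q.val := by simpa [mrel] using hv
      obtain rfl := Fin.ext h
      exact ⟨false, by simp⟩
    | bSq i' q => exact (hbSq _ _ hvR).elim
    | xS i' =>
      obtain rfl : i' = i := by simpa [mrel] using hv
      exact (hx hvR).elim
    | _ => simp [mrel] at hv
  have hout : (Finset.univ : Finset Unit).card ≤ degIn (mgraph vec t sel) Rᶜ (MV.aSq i p) :=
    Finset.card_le_ncard_of_injOn (fun _ => MV.xS i)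
      (Function.injective_of_subsingleton _).injOn
      (by simpa [mgraph, SimpleGraph.fromRel_adj, mrel] using hx)
  simp only [Finset.card_univ, Fintype.card_bool, Fintype.card_unit] at hin hout
  omega

theorem MV.abc_injective : Function.Injective (MV.abc (vec := vec) (t := t)) := by
  rintro ⟨i, (p | p) | p⟩ ⟨i', (p' | p') | p'⟩ h <;> simp only [MV.abc] at h <;> cases h <;> rfl

theorem sum_le_card_filter_abc (hR : IsStrongOffensiveAlliance (mgraph vec t sel) R)
    (haA : ∀ p : Fin 4, MV.aA p ∈ R ↔ p ≠ 3) (ha : MV.a ∉ R) [DecidablePred (· ∈ R)] :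
    ∑ i, 2 * (M vec i + 1) ≤ (Finset.univ.filter fun x => MV.abc x ∈ R).card := by
  have hdeg := hR.2 MV.a ⟨ha, MV.aA 0, (haA 0).2 (by decide), by
    simp [mgraph, SimpleGraph.fromRel_adj, mrel]⟩
  have hcard : (Finset.univ : Finset (Σ i, (Fin (M vec i + 1) ⊕ Fin (M vec i + 1)) ⊕
      Fin (2 * M vec i + 2))).card = 2 * ∑ i, 2 * (M vec i + 1) := by
    simp only [Finset.card_univ, Fintype.card_sigma, Fintype.card_sum, Fintype.card_fin]
    rw [Finset.mul_sum]
    exact Finset.sum_congr rfl fun i _ => by ring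
  have hsplit := Finset.card_filter_add_card_filter_not
    (s := (Finset.univ : Finset (Σ i, (Fin (M vec i + 1) ⊕ Fin (M vec i + 1)) ⊕
      Fin (2 * M vec i + 2)))) fun x => MV.abc x ∈ R
  have hin : degIn (mgraph vec t sel) R MV.a ≤ ((Finset.univ.filter fun x => MV.abc x ∈ R).disjSum
      (Finset.univ.filter fun p : Fin 4 => p ≠ 3)).card := by
    refine Set.ncard_le_card_of_forall_exists (Sum.elim MV.abc MV.aA) ?_
    rintro v ⟨hv, hvR⟩
    rw [SimpleGraph.mem_neighborSet, mgraph, SimpleGraph.fromRel_adj] at hv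
    cases v with
    | aS i p => exact ⟨.inl ⟨i, .inl (.inl p)⟩,
        Finset.inl_mem_disjSum.2 (Finset.mem_filter.2 ⟨Finset.mem_univ _, hvR⟩), rfl⟩
    | bS i p => exact ⟨.inl ⟨i, .inl (.inr p)⟩,
        Finset.inl_mem_disjSum.2 (Finset.mem_filter.2 ⟨Finset.mem_univ _, hvR⟩), rfl⟩
    | cS i p => exact ⟨.inl ⟨i, .inr p⟩,
        Finset.inl_mem_disjSum.2 (Finset.mem_filter.2 ⟨Finset.mem_univ _, hvR⟩), rfl⟩
    | aA p => exact ⟨.inr p, by simpa [haA] using hvR, rfl⟩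
    | _ => simp [mrel] at hv
  have hout : ((Finset.univ.filter fun x => MV.abc x ∉ R).disjSum
      (Finset.univ : Finset Unit)).card ≤ degIn (mgraph vec t sel) Rᶜ MV.a := by
    refine Finset.card_le_ncard_of_injOn (Sum.elim MV.abc fun _ => MV.aA 3)
      (Function.Injective.injOn ?_) ?_
    · refine MV.abc_injective.sumElim (Function.injective_of_subsingleton _) ?_
      rintro ⟨i, (p | p) | p⟩ _ <;> simp [MV.abc]
    · rintro (x | p) h
      · refine ⟨?_, (Finset.mem_filter.1 (Finset.inl_mem_disjSum.1 h)).2⟩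
        rcases x with ⟨i, (p | p) | p⟩ <;>
          simp [mgraph, SimpleGraph.fromRel_adj, mrel, MV.abc]
      · simp [mgraph, SimpleGraph.fromRel_adj, mrel, haA]
  have hthree : (Finset.univ.filter fun p : Fin 4 => p ≠ 3).card = 3 := rfl
  simp only [Finset.card_disjSum, Finset.card_univ, Fintype.card_unit] at hin hout hsplit hcard
  omega

theorem card_add_card_le_ncard (ht : ∀ j, t j ≤ ∑ i, vec i j) (htri : Vtri vec t ⊆ R)
    [DecidablePred (· ∈ R)] :
    (Finset.univ.filter fun x => MV.abc x ∈ R).card +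
      (Finset.univ.filter fun i => MV.xS i ∈ R).card +
      ((∑ j, 2 * ((∑ i, vec i j) - t j + 1)) + 5 * n + 3) ≤ R.ncard := by
  have h := Finset.card_le_ncard_of_injOn (T := R)
    (s := (Finset.univ.filter fun x => MV.abc x ∈ R).disjSum
      ((Finset.univ.filter fun i => MV.xS i ∈ R).disjSum
        ((Finset.univ : Finset (Σ j, Fin (2 * (∑ i, vec i j) - 2 * t j + 2))).disjSum
          ((Finset.univ.filter fun p : Fin 4 => p ≠ 3).disjSum
            ((Finset.univ : Finset (Fin n)) ×ˢ Finset.univ.filter fun p : Fin 6 => p ≠ 5)))))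
    (Sum.elim MV.abc (Sum.elim MV.xS MV.tri)) (Function.Injective.injOn ?_) ?_
  · have hthree : (Finset.univ.filter fun p : Fin 4 => p ≠ 3).card = 3 := rfl
    have hfive : (Finset.univ.filter fun p : Fin 6 => p ≠ 5).card = 5 := rfl
    have hsum : ∑ j, (2 * (∑ i, vec i j) - 2 * t j + 2) =
        ∑ j, 2 * ((∑ i, vec i j) - t j + 1) :=
      Finset.sum_congr rfl fun j _ => by have := ht j; omega
    simp only [Finset.card_disjSum, Finset.card_product, Finset.card_univ, Fintype.card_sigma,
      Fintype.card_fin, hthree, hfive, hsum] at h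
    omega
  · refine MV.abc_injective.sumElim (Function.Injective.sumElim ?_ ?_ ?_) ?_
    · exact fun _ _ h => MV.xS.inj h
    · rintro (⟨j, p⟩ | p | ⟨i, p⟩) (⟨j', p'⟩ | p' | ⟨i', p'⟩) h <;>
        simp only [MV.tri] at h <;> cases h <;> rfl
    · rintro i (⟨j, p⟩ | p | ⟨i', p⟩) <;> simp [MV.tri]
    · rintro ⟨i, (p | p) | p⟩ (i' | ⟨j, p'⟩ | p' | ⟨i', p'⟩) <;> simp [MV.abc, MV.tri]
  · rintro (x | i | ⟨j, p⟩ | p | ⟨i, p⟩) hx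
    · simpa using hx
    · simpa using hx
    · exact htri (.inl ⟨j, p, rfl⟩)
    · exact htri (.inr (.inl ⟨p, by simpa using hx, rfl⟩))
    · exact htri (.inr (.inr ⟨i, p, by simpa using hx, rfl⟩))

end Gadget

theorem stmt3 {k n : ℕ} (hk : 1 ≤ k) (hn : 1 ≤ n) (k' : ℕ)
    (vec : Fin n → Fin k → ℕ) (t : Fin k → ℕ)
    (ht : ∀ j, t j ≤ ∑ i, vec i j)
    (sel : (i : Fin n) → (j : Fin k) → Finset (Fin (M vec i + 1)))
    (hsel : ∀ i j, (sel i j).card = vec i j)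
    (R : Set (MV k n vec t))
    (hR : IsStrongOffensiveAlliance (mgraph vec t sel) R)
    (h1 : 1 ≤ R.ncard) (h2 : R.ncard ≤ rval vec t k')
    (h3 : Vtri vec t ⊆ R) (h4 : R ∩ Vsq vec t = ∅) :
    ∃ S' : Finset (Fin n), S'.card ≤ k' ∧ ∀ j, t j ≤ ∑ i ∈ S', vec i j := by
  classical
  have hsq : ∀ v ∈ Vsq vec t, v ∉ R := fun v hv hvR => h4.subset ⟨hvR, hv⟩
  refine ⟨Finset.univ.filter fun i => MV.xS i ∈ R, ?_, fun j => ?_⟩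
  · have hab := sum_le_card_filter_abc hR
      (fun p => ⟨fun hp h => hsq _ (by simp [Vsq, h]) hp, fun hp => h3 (by simp [Vtri, hp])⟩)
      (hsq _ (by simp [Vsq]))
    have hbudget := card_add_card_le_ncard ht h3
    rw [rval] at h2
    omega
  · refine (le_card_filter_sel hsel ht hR (fun j p => h3 (by simp [Vtri]))
      (fun j => hsq _ (by simp [Vsq])) (fun j p => hsq _ (by simp [Vsq])) j).trans ?_
    simp only [← hsel]
    rw [← Finset.card_sigma]
    refine Finset.card_le_card fun x hx => ?_
    simp only [Finset.mem_filter, Finset.mem_sigma, Finset.mem_univ, true_and] at hx ⊢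
    exact ⟨xS_mem_of_aS_mem hR (fun i p => hsq _ (by simp [Vsq]))
      (fun i p => hsq _ (by simp [Vsq])) hx.2, hx.1⟩
end

section
/- The graph obtained from G by deleting the k+1 vertices U ∪ {a} is acyclic, and every connected component of this graph contains a vertex whose graph distance to every vertex of that component is at most 5. -/
/-- A graph whose edges all join a vertex to its parent, of smaller rank, is acyclic. -/
theorem SimpleGraph.isAcyclic_of_parent {V : Type*} {G : SimpleGraph V} (par : V → V)
    (rank : V → ℕ)
    (h : ∀ v w, G.Adj v w → (par v = w ∧ rank w < rank v) ∨ (par w = v ∧ rank v < rank w)) :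
    G.IsAcyclic := by
  classical
  intro u c hc
  obtain ⟨x, hx, hmax⟩ := c.support.toFinset.exists_max_image rank
    ⟨u, List.mem_toFinset.2 c.start_mem_support⟩
  rw [List.mem_toFinset] at hx
  have hc' := hc.rotate hx
  have key : ∀ y ∈ (c.rotate x hx).support, G.Adj x y → par x = y := by
    intro y hy hxy
    rcases h x y hxy with h' | h'
    · exact h'.1
    · rw [SimpleGraph.Walk.mem_support_rotate_iff] at hy
      exact absurd h'.2 (hmax y (List.mem_toFinset.2 hy)).not_gt
  refine hc'.snd_ne_penultimate ?_
  exact (key _ (SimpleGraph.Walk.getVert_mem_support ..)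
      (SimpleGraph.Walk.adj_snd hc'.not_nil)).symm.trans
    (key _ (SimpleGraph.Walk.getVert_mem_support ..)
      (SimpleGraph.Walk.adj_penultimate hc'.not_nil).symm)

/-- If every edge joins a vertex to its parent and the parent map stabilises after `m` steps,
every component has a vertex at distance at most `m` from all its vertices. -/
theorem SimpleGraph.exists_center_of_parent {V : Type*} {G : SimpleGraph V} (par : V → V)
    (m : ℕ) (h : ∀ v w, G.Adj v w → par v = w ∨ par w = v)
    (hpar : ∀ v, par v = v ∨ G.Adj v (par v))
    (hm : ∀ v, par^[m] (par v) = par^[m] v) (c : G.ConnectedComponent) :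
    ∃ v, G.connectedComponentMk v = c ∧
      ∀ w, G.connectedComponentMk w = c → G.dist v w ≤ m := by
  have hwalk : ∀ j v, ∃ p : G.Walk v (par^[j] v), p.length ≤ j := by
    intro j
    induction j with
    | zero => exact fun v => ⟨.nil, le_rfl⟩
    | succ j ih =>
      intro v
      obtain ⟨p, hp⟩ := ih (par v)
      rw [Function.iterate_succ_apply]
      rcases hpar v with hv | hv
      · rw [hv]
        obtain ⟨p, hp⟩ := ih v
        exact ⟨p, hp.trans j.le_succ⟩
      · exact ⟨.cons hv p, by simpa using hp⟩
  have hroot : ∀ v w, G.Reachable v w → par^[m] v = par^[m] w := by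
    rintro v w ⟨p⟩
    induction p with
    | nil => rfl
    | cons hadj _ ih =>
      rw [← ih]
      rcases h _ _ hadj with hv | hv <;> rw [← hv, hm]
  induction c using SimpleGraph.ConnectedComponent.ind with
  | h v₀ =>
    refine ⟨par^[m] v₀, ?_, fun w hw => ?_⟩
    · obtain ⟨p, -⟩ := hwalk m v₀
      exact (SimpleGraph.ConnectedComponent.sound ⟨p⟩).symm
    · rw [← hroot w v₀ (SimpleGraph.ConnectedComponent.exact hw), SimpleGraph.dist_comm]
      obtain ⟨p, hp⟩ := hwalk m w
      exact (SimpleGraph.dist_le p).trans hp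

namespace MV

variable {k n : ℕ} {vec : Fin n → Fin k → ℕ} {t : Fin k → ℕ}

/-- The parent of a vertex when the gadget of each `s` is rooted at `z_s`. -/
def parent : MV k n vec t → MV k n vec t
  | aS i p => aSq i p
  | bS i p => aSq i p
  | bSq i p => aSq i p
  | aSq i _ => xS i
  | xS i => zv i
  | yS i => zv i
  | zS i _ => zv i
  | cS i _ => yS i
  | v => v

/-- The depth of a vertex when the gadget of each `s` is rooted at `z_s`. -/
def depth : MV k n vec t → ℕ
  | aS _ _ => 3
  | bS _ _ => 3
  | bSq _ _ => 3
  | aSq _ _ => 2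
  | cS _ _ => 2
  | xS _ => 1
  | yS _ => 1
  | zS _ _ => 1
  | _ => 0

theorem parent_iterate_stable (v : MV k n vec t) :
    parent^[3] (parent v) = parent^[3] v := by
  cases v <;> rfl

/-- The vertices outside `U ∪ {a}`. -/
def Kept (v : MV k n vec t) : Prop := ¬ ((∃ j, v = u j) ∨ v = a)

theorem Kept.parent {v : MV k n vec t} (hv : v.Kept) : v.parent.Kept := by
  cases v <;> simp_all [Kept, MV.parent]

theorem parent_of_mrel
    {sel : (i : Fin n) → (j : Fin k) → Finset (Fin (M vec i + 1))} {v w : MV k n vec t}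
    (hv : v.Kept) (h : mrel vec t sel v w) :
    (v.parent = w ∧ w.depth < v.depth) ∨ (w.parent = v ∧ v.depth < w.depth) := by
  cases v <;> cases w <;>
    simp_all [Kept, mrel, parent, depth]
  all_goals
    obtain ⟨rfl, h⟩ := h
    simp [Fin.ext h]

theorem parent_of_adj
    {sel : (i : Fin n) → (j : Fin k) → Finset (Fin (M vec i + 1))} {v w : MV k n vec t}
    (hv : v.Kept) (hw : w.Kept) (h : (mgraph vec t sel).Adj v w) :
    (v.parent = w ∧ w.depth < v.depth) ∨ (w.parent = v ∧ v.depth < w.depth) :=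
  h.2.elim (parent_of_mrel hv) fun h => (parent_of_mrel hw h).symm

theorem parent_eq_or_adj (sel : (i : Fin n) → (j : Fin k) → Finset (Fin (M vec i + 1)))
    (v : MV k n vec t) : v.parent = v ∨ (mgraph vec t sel).Adj v v.parent := by
  cases v <;> simp [parent, mgraph, mrel]

end MV

theorem stmt5 {k n : ℕ} (hk : 1 ≤ k) (hn : 1 ≤ n) (k' : ℕ)
    (vec : Fin n → Fin k → ℕ) (t : Fin k → ℕ)
    (ht : ∀ j, t j ≤ ∑ i, vec i j)
    (sel : (i : Fin n) → (j : Fin k) → Finset (Fin (M vec i + 1)))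
    (hsel : ∀ i j, (sel i j).card = vec i j) :
    let H := SimpleGraph.induce
      {v : MV k n vec t | ¬ ((∃ j, v = MV.u j) ∨ v = MV.a)} (mgraph vec t sel)
    H.IsAcyclic ∧
      ∀ c : H.ConnectedComponent, ∃ v, H.connectedComponentMk v = c ∧
        ∀ w, H.connectedComponentMk w = c → H.dist v w ≤ 5 := by
  intro H
  let par : {v : MV k n vec t | ¬ ((∃ j, v = MV.u j) ∨ v = MV.a)} →
      {v : MV k n vec t | ¬ ((∃ j, v = MV.u j) ∨ v = MV.a)} :=
    fun v => ⟨v.1.parent, MV.Kept.parent v.2⟩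
  have hadj : ∀ v w, H.Adj v w →
      (par v = w ∧ w.1.depth < v.1.depth) ∨ (par w = v ∧ v.1.depth < w.1.depth) := by
    intro v w h
    simpa only [par, Subtype.ext_iff] using MV.parent_of_adj v.2 w.2 h
  refine ⟨SimpleGraph.isAcyclic_of_parent par (fun v => v.1.depth) hadj, fun c => ?_⟩
  obtain ⟨v, hv, hdist⟩ := SimpleGraph.exists_center_of_parent par 3
    (fun v w h => (hadj v w h).imp And.left And.left)
    (fun v => (MV.parent_eq_or_adj sel v.1).imp Subtype.ext id)
    (fun v => Subtype.ext (MV.parent_iterate_stable v.1)) c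
  exact ⟨v, hv, fun w hw => (hdist w hw).trans (by norm_num)⟩
end

section
/- G has a strong offensive alliance R with 1 ≤ |R| ≤ r, V_△ ⊆ R, and R ∩ V_□ = ∅ if and only if G' has a strong offensive alliance R' with 1 ≤ |R'| ≤ r + 1, y ∈ R', and R' ∩ V_□' = ∅. -/
/-- The new vertices added to `G`: the forbidden vertex `x`, the necessary vertex `y`,
and a set `V_x^□` of `m` (`= ℓ - 1`) further forbidden vertices. -/
inductive ExtV (m : ℕ) : Type where
  | x : ExtV m
  | y : ExtV m
  | w (p : Fin m) : ExtV m

/-- One direction of each edge of `G'`: the edges of `G`, the edge `(x, y)`, the edges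
from `x` to every vertex of `V_△`, and the edges from `x` to every vertex of `V_x^□`. -/
def erel {V : Type*} (G : SimpleGraph V) (Vtri : Finset V) (m : ℕ) :
    V ⊕ ExtV m → V ⊕ ExtV m → Prop
  | Sum.inl a, Sum.inl b => G.Adj a b
  | Sum.inr ExtV.x, Sum.inr ExtV.y => True
  | Sum.inr ExtV.x, Sum.inl v => v ∈ Vtri
  | Sum.inr ExtV.x, Sum.inr (ExtV.w _) => True
  | _, _ => False

namespace ExtendedGraph

variable {V : Type*} {G : SimpleGraph V} {T : Finset V} {m : ℕ}

/-- The graph obtained from `G` by attaching the vertices of `ExtV m`. -/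
abbrev extGraph (G : SimpleGraph V) (T : Finset V) (m : ℕ) : SimpleGraph (V ⊕ ExtV m) :=
  SimpleGraph.fromRel (erel G T m)

/-- The set of vertices of the extended graph consisting of `R` and `y`. -/
abbrev extSet (R : Set V) (m : ℕ) : Set (V ⊕ ExtV m) :=
  insert (Sum.inr ExtV.y) (Sum.inl '' R)

lemma adj_inl_inl {a b : V} :
    (extGraph G T m).Adj (Sum.inl a) (Sum.inl b) ↔ G.Adj a b := by
  simp only [SimpleGraph.fromRel_adj, erel, ne_eq, Sum.inl.injEq]
  exact ⟨fun h => h.2.elim id SimpleGraph.Adj.symm, fun h => ⟨h.ne, Or.inl h⟩⟩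

lemma adj_x_y : (extGraph G T m).Adj (Sum.inr ExtV.x) (Sum.inr ExtV.y) := by
  simp [erel]

lemma adj_inl_inr {v : V} {e : ExtV m} (h : (extGraph G T m).Adj (Sum.inl v) (Sum.inr e)) :
    v ∈ T := by
  cases e <;> simp_all [erel]

lemma adj_y_inl {v : V} : ¬ (extGraph G T m).Adj (Sum.inr ExtV.y) (Sum.inl v) := by
  simp [erel]

lemma adj_w {p : Fin m} {u : V ⊕ ExtV m}
    (h : (extGraph G T m).Adj u (Sum.inr (ExtV.w p))) : u = Sum.inr ExtV.x := by
  rcases u with u | (_ | _ | q) <;> simp_all [erel]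

lemma degIn_inl {v : V} (hv : v ∉ T) (S : Set (V ⊕ ExtV m)) :
    degIn (extGraph G T m) S (Sum.inl v) = degIn G (Sum.inl ⁻¹' S) v := by
  rw [degIn, degIn, ← Set.ncard_image_of_injective (G.neighborSet v ∩ Sum.inl ⁻¹' S)
    (Sum.inl_injective (β := ExtV m))]
  refine congrArg Set.ncard ?_
  ext (u | e)
  · simp only [Set.mem_inter_iff, SimpleGraph.mem_neighborSet, adj_inl_inl,
      Sum.inl_injective.mem_set_image, Set.mem_preimage]
  · simp only [Set.mem_inter_iff, SimpleGraph.mem_neighborSet, Set.mem_image, reduceCtorEq,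
      and_false, exists_false, iff_false, not_and]
    exact fun h => absurd (adj_inl_inr h) hv

lemma degIn_extSet_x (R : Set V) :
    degIn (extGraph G T m) (extSet R m) (Sum.inr ExtV.x) = ((T : Set V) ∩ R).ncard + 1 := by
  have : (extGraph G T m).neighborSet (Sum.inr ExtV.x) ∩ extSet R m =
      insert (Sum.inr ExtV.y) (Sum.inl '' ((T : Set V) ∩ R)) := by
    ext (u | (_ | _ | p)) <;> simp [erel]
  rw [degIn, this, Set.ncard_insert_of_notMem (by simp)
    ((T.finite_toSet.inter_of_left R).image _),
    Set.ncard_image_of_injective _ Sum.inl_injective]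

lemma degIn_compl_extSet_x (R : Set V) :
    degIn (extGraph G T m) (extSet R m)ᶜ (Sum.inr ExtV.x) = ((T : Set V) \ R).ncard + m := by
  have : (extGraph G T m).neighborSet (Sum.inr ExtV.x) ∩ (extSet R m)ᶜ =
      Sum.inl '' ((T : Set V) \ R) ∪ Set.range fun p : Fin m => Sum.inr (ExtV.w p) := by
    ext (u | (_ | _ | p)) <;> simp [erel]
  have hw : Function.Injective fun p : Fin m => (Sum.inr (ExtV.w p) : V ⊕ ExtV m) :=
    fun p q h => by simpa using h
  rw [degIn, this, Set.ncard_union_eq _ ((T.finite_toSet.sdiff).image _) (Set.finite_range _),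
    Set.ncard_image_of_injective _ Sum.inl_injective, ← Set.image_univ,
    Set.ncard_image_of_injective _ hw, Set.ncard_univ, Nat.card_fin]
  rw [Set.disjoint_left]
  rintro _ ⟨v, -, rfl⟩
  simp

lemma ncard_extSet [Finite V] (R : Set V) : (extSet R m).ncard = R.ncard + 1 := by
  rw [Set.ncard_insert_of_notMem (by simp) (R.toFinite.image _),
    Set.ncard_image_of_injective _ Sum.inl_injective]

lemma preimage_extSet (R : Set V) : Sum.inl ⁻¹' extSet R m = R := by
  ext; simp

lemma x_mem_nbhd_extSet (R : Set V) :
    Sum.inr ExtV.x ∈ nbhd (extGraph G T m) (extSet R m) :=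
  ⟨by simp, Sum.inr ExtV.y, by simp, adj_x_y.symm⟩

lemma inl_mem_nbhd_extSet {R : Set V} {v : V} :
    Sum.inl v ∈ nbhd (extGraph G T m) (extSet R m) ↔ v ∈ nbhd G R := by
  simp only [nbhd, Set.mem_ofPred_eq]
  constructor
  · rintro ⟨hv, _, rfl | ⟨u, hu, rfl⟩, h⟩
    · exact absurd h adj_y_inl
    · exact ⟨by simpa using hv, u, hu, adj_inl_inl.1 h⟩
  · rintro ⟨hv, u, hu, h⟩
    exact ⟨by simpa using hv, Sum.inl u, by simpa using hu, adj_inl_inl.2 h⟩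

lemma isStrongOffensiveAlliance_extSet_iff {R : Set V} (hT : T.card = m + 1) :
    IsStrongOffensiveAlliance (extGraph G T m) (extSet R m) ↔
      IsStrongOffensiveAlliance G R ∧ (T : Set V) ⊆ R := by
  have hx : degIn (extGraph G T m) (extSet R m)ᶜ (Sum.inr ExtV.x) + 2 ≤
      degIn (extGraph G T m) (extSet R m) (Sum.inr ExtV.x) ↔ (T : Set V) ⊆ R := by
    rw [degIn_extSet_x, degIn_compl_extSet_x, ← Set.sdiff_eq_empty,
      ← Set.ncard_eq_zero T.finite_toSet.sdiff]
    have := Set.ncard_inter_add_ncard_sdiff_eq_ncard (T : Set V) R T.finite_toSet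
    rw [Set.ncard_coe_finset] at this
    omega
  have hv {v : V} (hTR : (T : Set V) ⊆ R) (hvR : v ∉ R) :
      degIn (extGraph G T m) (extSet R m)ᶜ (Sum.inl v) + 2 ≤
      degIn (extGraph G T m) (extSet R m) (Sum.inl v) ↔ degIn G Rᶜ v + 2 ≤ degIn G R v := by
    have : v ∉ T := fun h => hvR (hTR h)
    rw [degIn_inl this, degIn_inl this, Set.preimage_compl, preimage_extSet]
  constructor
  · rintro ⟨-, h⟩
    have hTR := hx.1 (h _ (x_mem_nbhd_extSet R))
    obtain ⟨t, ht⟩ : T.Nonempty := Finset.card_pos.1 (by omega)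
    exact ⟨⟨⟨t, hTR ht⟩, fun v h' => (hv hTR h'.1).1 (h _ (inl_mem_nbhd_extSet.2 h'))⟩, hTR⟩
  · rintro ⟨⟨-, h⟩, hTR⟩
    refine ⟨⟨_, Set.mem_insert _ _⟩, ?_⟩
    rintro (v | (_ | _ | p)) hmem
    · have h' := inl_mem_nbhd_extSet.1 hmem
      exact (hv hTR h'.1).2 (h v h')
    · exact hx.2 hTR
    · exact absurd (Set.mem_insert _ _) hmem.1
    · obtain ⟨-, u, hu, huw⟩ := hmem
      rw [adj_w huw] at hu
      simp at hu

lemma extSet_preimage {R' : Set (V ⊕ ExtV m)} (hy : Sum.inr ExtV.y ∈ R')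
    (hx : Sum.inr ExtV.x ∉ R') (hw : ∀ p, Sum.inr (ExtV.w p) ∉ R') :
    extSet (Sum.inl ⁻¹' R') m = R' := by
  ext (u | (_ | _ | p)) <;> simp_all

end ExtendedGraph

open ExtendedGraph in
theorem stmt6 {V : Type*} [Fintype V] (G : SimpleGraph V) (r : ℕ) (hr : 1 ≤ r)
    (Vtri : Finset V) (hℓ : 2 ≤ Vtri.card) (Vsq : Set V)
    (hdisj : (↑Vtri : Set V) ∩ Vsq = ∅) :
    let G' : SimpleGraph (V ⊕ ExtV (Vtri.card - 1)) :=
      SimpleGraph.fromRel (erel G Vtri (Vtri.card - 1))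
    let Vsq' : Set (V ⊕ ExtV (Vtri.card - 1)) :=
      {Sum.inr ExtV.x} ∪ {w | ∃ p, w = Sum.inr (ExtV.w p)} ∪ (Sum.inl '' Vsq)
    ((∃ R : Set V, IsStrongOffensiveAlliance G R ∧ 1 ≤ R.ncard ∧ R.ncard ≤ r ∧
        (↑Vtri : Set V) ⊆ R ∧ R ∩ Vsq = ∅) ↔
      (∃ R' : Set (V ⊕ ExtV (Vtri.card - 1)), IsStrongOffensiveAlliance G' R' ∧
        1 ≤ R'.ncard ∧ R'.ncard ≤ r + 1 ∧ Sum.inr ExtV.y ∈ R' ∧ R' ∩ Vsq' = ∅)) := by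
  intro G' Vsq'
  have hT : Vtri.card = Vtri.card - 1 + 1 := by omega
  constructor
  · rintro ⟨R, hR, -, hr', hTR, hsq⟩
    refine ⟨extSet R _, (isStrongOffensiveAlliance_extSet_iff hT).2 ⟨hR, hTR⟩, ?_, ?_,
      Set.mem_insert _ _, ?_⟩
    · rw [ncard_extSet]; omega
    · rw [ncard_extSet]; omega
    · rw [← Set.disjoint_iff_inter_eq_empty, Set.disjoint_left] at hsq ⊢
      rintro _ (rfl | ⟨u, hu, rfl⟩)
      · simp [Vsq']
      · simpa [Vsq'] using hsq hu
  · rintro ⟨R', hR', -, hr', hy, hsq⟩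
    rw [← Set.disjoint_iff_inter_eq_empty, Set.disjoint_right] at hsq
    have hext : extSet (Sum.inl ⁻¹' R') _ = R' :=
      extSet_preimage hy (hsq (by simp [Vsq'])) fun p => hsq (by simp [Vsq'])
    rw [← hext] at hR' hr'
    obtain ⟨hR, hTR⟩ := (isStrongOffensiveAlliance_extSet_iff hT).1 hR'
    rw [ncard_extSet] at hr'
    refine ⟨_, hR, (Set.ncard_pos).2 hR.1, by omega, hTR, ?_⟩
    rw [← Set.disjoint_iff_inter_eq_empty, Set.disjoint_right]
    exact fun v hv => hsq (Or.inr ⟨v, hv, rfl⟩)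
end

section
/- If R is a strong offensive alliance of G with 1 ≤ |R| ≤ r, x ∈ R, and R ∩ V_□ = ∅, then R ∪ T is an offensive alliance of G' with |R ∪ T| ≤ r + 4n and (R ∪ T) ∩ V_□' = ∅. -/
/-- The new vertices added to `G`: `t^□`, `x^□`, the `4n` forbidden vertices of `V_t^□`,
the `n` forbidden vertices of `V_x^□`, and the `4n` vertices of `T`. -/
inductive Gad (n : ℕ) : Type where
  | tsq : Gad n
  | xsq : Gad n
  | vt (p : Fin (4 * n)) : Gad n
  | vx (p : Fin n) : Gad n
  | tt (p : Fin (4 * n)) : Gad n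

/-- One direction of each edge of `G'`: the edges of `G`; `t^□` joined to every vertex of
`V_t^□`; `x^□` joined to every vertex of `V_x^□`; every vertex of `T` joined to `t^□` and
`x^□`; `x^□` joined to every vertex of `V(G) ∖ F`; and the edge `(x, t^□)`. -/
def grel {V : Type*} (G : SimpleGraph V) (n : ℕ) (F : Set V) (x : V) :
    V ⊕ Gad n → V ⊕ Gad n → Prop
  | Sum.inl a, Sum.inl b => G.Adj a b
  | Sum.inr Gad.tsq, Sum.inr (Gad.vt _) => True
  | Sum.inr Gad.xsq, Sum.inr (Gad.vx _) => True
  | Sum.inr (Gad.tt _), Sum.inr Gad.tsq => True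
  | Sum.inr (Gad.tt _), Sum.inr Gad.xsq => True
  | Sum.inr Gad.xsq, Sum.inl v => v ∉ F
  | Sum.inl v, Sum.inr Gad.tsq => v = x
  | _, _ => False

/-- The set `T = {t_1, …, t_{4n}}`. -/
def Tset {V : Type*} (n : ℕ) : Set (V ⊕ Gad n) := {w | ∃ p, w = Sum.inr (Gad.tt p)}

/-- The set `V_□' = V_□ ∪ V_t^□ ∪ V_x^□ ∪ {t^□, x^□}` of forbidden vertices of `G'`. -/
def VsqG' {V : Type*} (n : ℕ) (Vsq : Set V) : Set (V ⊕ Gad n) :=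
  (Sum.inl '' Vsq) ∪ {w | ∃ p, w = Sum.inr (Gad.vt p)} ∪
    {w | ∃ p, w = Sum.inr (Gad.vx p)} ∪ {Sum.inr Gad.tsq, Sum.inr Gad.xsq}

theorem ncard_range_of_injective {α β : Type*} [Fintype α] {f : α → β}
    (hf : Function.Injective f) : (Set.range f).ncard = Fintype.card α := by
  rw [← Set.image_univ, Set.ncard_image_of_injective _ hf, Set.ncard_univ, Nat.card_eq_fintype_card]

section Gadget

variable {V : Type*} {n : ℕ}

theorem Tset_eq_range : (Tset n : Set (V ⊕ Gad n)) = Set.range (fun p => Sum.inr (Gad.tt p)) := by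
  ext w
  simp [Tset, eq_comm]

theorem finite_Tset : (Tset n : Set (V ⊕ Gad n)).Finite := by
  rw [Tset_eq_range]
  exact Set.finite_range _

theorem ncard_Tset : (Tset n : Set (V ⊕ Gad n)).ncard = 4 * n := by
  rw [Tset_eq_range, ncard_range_of_injective, Fintype.card_fin]
  intro p q h
  simpa using h

theorem ncard_image_inl_union_Tset [Finite V] (R : Set V) :
    (Sum.inl '' R ∪ Tset n : Set (V ⊕ Gad n)).ncard = R.ncard + 4 * n := by
  rw [Set.ncard_union_eq _ (Set.toFinite _) finite_Tset,
    Set.ncard_image_of_injective _ Sum.inl_injective, ncard_Tset]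
  rw [Set.disjoint_left]
  rintro _ ⟨v, -, rfl⟩ ⟨p, hp⟩
  cases hp

variable (G : SimpleGraph V) (F R : Set V) (x : V)

local notation "Gx" => SimpleGraph.fromRel (grel G n F x)
local notation "RT" => (Sum.inl '' R ∪ Tset n : Set (V ⊕ Gad n))

theorem degIn_tsq (hx : x ∈ R) : degIn Gx RT (Sum.inr Gad.tsq) = 4 * n + 1 := by
  have h : (Gx).neighborSet (Sum.inr Gad.tsq) ∩ RT = insert (Sum.inl x) (Tset n) := by
    ext w
    rcases w with v | _ | _ | p | p | p <;> simp [grel, Tset]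
    rintro rfl
    exact hx
  rw [degIn, h, Set.ncard_insert_of_notMem _ finite_Tset, ncard_Tset]
  simp [Tset]

theorem degIn_compl_tsq (hx : x ∈ R) : degIn Gx RTᶜ (Sum.inr Gad.tsq) = 4 * n := by
  have h : (Gx).neighborSet (Sum.inr Gad.tsq) ∩ RTᶜ =
      Set.range (fun p => Sum.inr (Gad.vt p)) := by
    ext w
    rcases w with v | _ | _ | p | p | p <;> simp [grel, Tset]
    rintro rfl
    exact hx
  rw [degIn, h, ncard_range_of_injective, Fintype.card_fin]
  intro p q h
  simpa using h

theorem degIn_xsq [Finite V] (hRF : Disjoint R F) :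
    degIn Gx RT (Sum.inr Gad.xsq) = R.ncard + 4 * n := by
  have h : (Gx).neighborSet (Sum.inr Gad.xsq) ∩ RT = RT := by
    ext w
    rcases w with v | _ | _ | p | p | p <;> simp [grel, Tset]
    exact fun hv => Set.disjoint_left.1 hRF hv
  rw [degIn, h, ncard_image_inl_union_Tset]

theorem degIn_compl_xsq_le [Finite V] :
    degIn Gx RTᶜ (Sum.inr Gad.xsq) ≤ Nat.card V + n := by
  have h : (Gx).neighborSet (Sum.inr Gad.xsq) ∩ RTᶜ =
      Sum.inl '' (Fᶜ ∩ Rᶜ) ∪ Set.range (fun p => Sum.inr (Gad.vx p)) := by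
    ext w
    rcases w with v | _ | _ | p | p | p <;> simp [grel, Tset]
  rw [degIn, h]
  refine (Set.ncard_union_le _ _).trans (add_le_add ?_ ?_)
  · rw [Set.ncard_image_of_injective _ Sum.inl_injective, ← Set.ncard_univ]
    exact Set.ncard_le_ncard (Set.subset_univ _)
  · rw [ncard_range_of_injective, Fintype.card_fin]
    intro p q h
    simpa using h

theorem degIn_inl (v : V) : degIn Gx RT (Sum.inl v) = degIn G R v := by
  have h : (Gx).neighborSet (Sum.inl v) ∩ RT = Sum.inl '' (G.neighborSet v ∩ R) := by
    ext w
    rcases w with u | _ | _ | p | p | p <;> simp [grel, Tset]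
    rw [G.adj_comm u v, or_self]
    exact fun _ => ⟨fun h => h.2, fun h => ⟨h.ne, h⟩⟩
  rw [degIn, h, Set.ncard_image_of_injective _ Sum.inl_injective, degIn]

theorem degIn_compl_inl_le [Finite V] {v : V} (hv : v ≠ x) :
    degIn Gx RTᶜ (Sum.inl v) ≤ degIn G Rᶜ v + 1 := by
  have h : (Gx).neighborSet (Sum.inl v) ∩ RTᶜ ⊆
      insert (Sum.inr Gad.xsq) (Sum.inl '' (G.neighborSet v ∩ Rᶜ)) := by
    rintro (u | _ | _ | p | p | p) <;> simp [grel, Tset, hv]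
    rw [G.adj_comm u v, or_self]
    exact fun _ h hu => ⟨h, hu⟩
  refine (Set.ncard_le_ncard h (Set.toFinite _)).trans ((Set.ncard_insert_le _ _).trans ?_)
  rw [Set.ncard_image_of_injective _ Sum.inl_injective, degIn]

theorem mem_nbhd_of_inl {v : V} (hv : Sum.inl v ∈ nbhd Gx RT) : v ∈ nbhd G R := by
  obtain ⟨hvR, w, hw, hadj⟩ := hv
  refine ⟨fun h => hvR (Or.inl ⟨v, h, rfl⟩), ?_⟩
  rcases hw with ⟨u, hu, rfl⟩ | ⟨p, rfl⟩
  · refine ⟨u, hu, ?_⟩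
    simpa [grel, G.adj_comm v u] using hadj.2
  · simp [grel] at hadj

theorem IsStrongOffensiveAlliance.isOffensiveAlliance_union_Tset [Finite V]
    (hn : n = Nat.card V) (hR : IsStrongOffensiveAlliance G R) (hx : x ∈ R)
    (hRF : Disjoint R F) : IsOffensiveAlliance Gx RT := by
  refine ⟨⟨_, Or.inl ⟨x, hx, rfl⟩⟩, ?_⟩
  rintro (v | _ | _ | p | p | p) hv
  · have hvG := mem_nbhd_of_inl G F R x hv
    have hvx : v ≠ x := by
      rintro rfl
      exact hvG.1 hx
    have h₁ := hR.2 v hvG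
    have h₂ := degIn_compl_inl_le (n := n) G F R x hvx
    rw [degIn_inl]
    omega
  · rw [degIn_tsq G F R x hx, degIn_compl_tsq G F R x hx]
  · have h₁ := degIn_compl_xsq_le (n := n) G F R x
    have h₂ : 0 < R.ncard := (Set.ncard_pos (Set.toFinite _)).2 ⟨x, hx⟩
    rw [degIn_xsq G F R x hRF]
    omega
  · obtain ⟨-, w, ⟨u, hu, rfl⟩ | ⟨q, rfl⟩, hadj⟩ := hv <;> simp [grel] at hadj
  · obtain ⟨-, w, ⟨u, hu, rfl⟩ | ⟨q, rfl⟩, hadj⟩ := hv <;> simp [grel] at hadj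
  · exact absurd (Or.inr ⟨p, rfl⟩) hv.1

end Gadget

theorem stmt7 {V : Type*} [Fintype V] (G : SimpleGraph V) (r : ℕ) (hr : 1 ≤ r)
    (Vsq : Set V) (x : V) (hx : x ∉ Vsq)
    (hdeg1 : ∀ v ∈ Vsq, (G.neighborSet v).ncard = 1 → ∃ w ∈ Vsq, G.Adj v w)
    (hdeg2 : ∀ v ∈ Vsq, 1 < (G.neighborSet v).ncard →
      ∃ w ∈ Vsq, (G.neighborSet w).ncard = 1 ∧ G.Adj v w) :
    let n := Fintype.card V
    let F : Set V := {v | v ∈ Vsq ∧ (G.neighborSet v).ncard = 1}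
    let G' : SimpleGraph (V ⊕ Gad n) := SimpleGraph.fromRel (grel G n F x)
    ∀ R : Set V, IsStrongOffensiveAlliance G R → 1 ≤ R.ncard → R.ncard ≤ r →
      x ∈ R → R ∩ Vsq = ∅ →
      IsOffensiveAlliance G' (Sum.inl '' R ∪ Tset n) ∧
        (Sum.inl '' R ∪ Tset n).ncard ≤ r + 4 * n ∧
        (Sum.inl '' R ∪ Tset n) ∩ VsqG' n Vsq = ∅ := by
  intro n F G' R hR _ hRr hxR hRV
  have hdisj : Disjoint R Vsq := Set.disjoint_iff_inter_eq_empty.2 hRV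
  refine ⟨?_, ?_, ?_⟩
  · exact hR.isOffensiveAlliance_union_Tset G F R x Nat.card_eq_fintype_card.symm hxR
      (hdisj.mono_right fun v hv => hv.1)
  · rw [ncard_image_inl_union_Tset]
    omega
  · rw [← Set.disjoint_iff_inter_eq_empty, Set.disjoint_left]
    rintro _ (⟨v, hv, rfl⟩ | ⟨p, rfl⟩)
    · simpa [VsqG'] using Set.disjoint_left.1 hdisj hv
    · simp [VsqG']
end

section
/- Every nonempty offensive alliance R' of G' with R' ∩ V_□' = ∅ satisfies T ∪ {x} ⊆ R'. -/
instance (n : ℕ) : Finite (Gad n) := by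
  let f : Bool ⊕ Fin (4 * n) ⊕ Fin n ⊕ Fin (4 * n) → Gad n
    | .inl true => .tsq
    | .inl false => .xsq
    | .inr (.inl p) => .vt p
    | .inr (.inr (.inl p)) => .vx p
    | .inr (.inr (.inr p)) => .tt p
  refine Finite.of_surjective f fun g => ?_
  cases g with
  | tsq => exact ⟨.inl true, rfl⟩
  | xsq => exact ⟨.inl false, rfl⟩
  | vt p => exact ⟨.inr (.inl p), rfl⟩
  | vx p => exact ⟨.inr (.inr (.inl p)), rfl⟩
  | tt p => exact ⟨.inr (.inr (.inr p)), rfl⟩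

/-- If an injective family of neighbours of `v ∈ N(R)` avoids an offensive alliance `R`,
then more vertices than the size of the family are neighbours of `v` in `R`. -/
theorem IsOffensiveAlliance.lt_degIn {W : Type*} [Finite W] {H : SimpleGraph W} {R : Set W}
    (hR : IsOffensiveAlliance H R) {v : W} (hv : v ∈ nbhd H R) {m : ℕ} (f : Fin m → W)
    (hf : Function.Injective f) (hadj : ∀ p, H.Adj v (f p)) (hout : ∀ p, f p ∉ R) :
    m < degIn H R v := by
  have hle : (Set.range f).ncard ≤ degIn H Rᶜ v :=
    Set.ncard_le_ncard (Set.range_subset_iff.2 fun p => ⟨hadj p, hout p⟩) (Set.toFinite _)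
  rw [Set.ncard_range_of_injective hf, Nat.card_fin] at hle
  exact Nat.lt_of_lt_of_le (Nat.lt_succ_of_le hle) (hR.2 v hv)

theorem ncard_Tset_union_singleton_le {V : Type*} (n : ℕ) (x : V) :
    (Tset n ∪ {Sum.inl x} : Set (V ⊕ Gad n)).ncard ≤ 4 * n + 1 := by
  have hT : (Tset n : Set (V ⊕ Gad n)) = Set.range (Sum.inr ∘ Gad.tt) := by
    ext w
    simp [Tset, eq_comm]
  refine (Set.ncard_union_le _ _).trans ?_
  rw [hT, Set.ncard_singleton,
    Set.ncard_range_of_injective (Sum.inr_injective.comp fun _ _ => Gad.tt.inj), Nat.card_fin]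

theorem stmt8 {V : Type*} [Fintype V] (G : SimpleGraph V) (r : ℕ) (hr : 1 ≤ r)
    (Vsq : Set V) (x : V) (hx : x ∉ Vsq)
    (hdeg1 : ∀ v ∈ Vsq, (G.neighborSet v).ncard = 1 → ∃ w ∈ Vsq, G.Adj v w)
    (hdeg2 : ∀ v ∈ Vsq, 1 < (G.neighborSet v).ncard →
      ∃ w ∈ Vsq, (G.neighborSet w).ncard = 1 ∧ G.Adj v w) :
    let n := Fintype.card V
    let F : Set V := {v | v ∈ Vsq ∧ (G.neighborSet v).ncard = 1}
    let G' : SimpleGraph (V ⊕ Gad n) := SimpleGraph.fromRel (grel G n F x)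
    ∀ R' : Set (V ⊕ Gad n), IsOffensiveAlliance G' R' → R' ∩ VsqG' n Vsq = ∅ →
      Tset n ∪ {Sum.inl x} ⊆ R' := by
  intro n F G' R' hR hdisj
  have hout : ∀ w ∈ VsqG' n Vsq, w ∉ R' := fun w hw hwR =>
    (Set.eq_empty_iff_forall_notMem.1 hdisj) w ⟨hwR, hw⟩
  have htsq : Sum.inr Gad.tsq ∉ R' := hout _ (by simp [VsqG'])
  have hxsq : Sum.inr Gad.xsq ∉ R' := hout _ (by simp [VsqG'])
  have hvt : ∀ p, Sum.inr (Gad.vt p) ∉ R' := fun p => hout _ (by simp [VsqG'])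
  have hvx : ∀ p, Sum.inr (Gad.vx p) ∉ R' := fun p => hout _ (by simp [VsqG'])
  have hVsq : ∀ v ∈ Vsq, Sum.inl v ∉ R' := fun v hv => hout _ (by simp [VsqG', hv])
  have hT : ∃ p, Sum.inr (Gad.tt p) ∈ R' := by
    by_contra! hT
    obtain ⟨w, hw⟩ := hR.1
    obtain ⟨v, rfl⟩ : ∃ v, w = Sum.inl v := by
      rcases w with v | (_ | _ | p | p | p)
      · exact ⟨v, rfl⟩
      · exact absurd hw htsq
      · exact absurd hw hxsq
      · exact absurd hw (hvt p)
      · exact absurd hw (hvx p)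
      · exact absurd hw (hT p)
    have hvF : v ∉ F := fun hv => hVsq v hv.1 hw
    have hlt := hR.lt_degIn (v := Sum.inr Gad.xsq)
      ⟨hxsq, _, hw, by simp [G', SimpleGraph.fromRel_adj, grel, hvF]⟩
      (fun p : Fin n => Sum.inr (Gad.vx p)) (Sum.inr_injective.comp fun _ _ => Gad.vx.inj)
      (fun p => by simp [G', SimpleGraph.fromRel_adj, grel]) hvx
    have hsub : G'.neighborSet (Sum.inr Gad.xsq) ∩ R' ⊆ Set.range Sum.inl := by
      rintro (v | (_ | _ | p | p | p)) ⟨-, hu⟩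
      · exact ⟨v, rfl⟩
      · exact absurd hu htsq
      · exact absurd hu hxsq
      · exact absurd hu (hvt p)
      · exact absurd hu (hvx p)
      · exact absurd hu (hT p)
    have hle := Set.ncard_le_ncard hsub (Set.toFinite _)
    rw [Set.ncard_range_of_injective Sum.inl_injective, Nat.card_eq_fintype_card] at hle
    exact absurd hlt (not_lt.2 hle)
  obtain ⟨p, hp⟩ := hT
  have hlt := hR.lt_degIn (v := Sum.inr Gad.tsq)
    ⟨htsq, _, hp, by simp [G', SimpleGraph.fromRel_adj, grel]⟩
    (fun p : Fin (4 * n) => Sum.inr (Gad.vt p)) (Sum.inr_injective.comp fun _ _ => Gad.vt.inj)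
    (fun p => by simp [G', SimpleGraph.fromRel_adj, grel]) hvt
  have hsub : G'.neighborSet (Sum.inr Gad.tsq) ∩ R' ⊆ Tset n ∪ {Sum.inl x} := by
    rintro (v | (_ | _ | p | p | p)) ⟨hadj, hu⟩
    · right
      simpa [G', SimpleGraph.fromRel_adj, grel] using hadj
    · exact absurd hu htsq
    · exact absurd hu hxsq
    · exact absurd hu (hvt p)
    · exact absurd hu (hvx p)
    · exact Or.inl ⟨p, rfl⟩
  rw [← Set.eq_of_subset_of_ncard_le hsub ((ncard_Tset_union_singleton_le n x).trans hlt)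
    (Set.toFinite _)]
  exact Set.inter_subset_right
end

section
/- G has a strong offensive alliance R with 1 ≤ |R| ≤ r, x ∈ R, and R ∩ V_□ = ∅ if and only if G' has an offensive alliance R' with 1 ≤ |R'| ≤ r + 4n and R' ∩ V_□' = ∅. -/
/-- The gadget vertices as an iterated disjoint union. -/
def gadEquiv (n : ℕ) :
    Gad n ≃ (Unit ⊕ Unit) ⊕ (Fin (4 * n) ⊕ Fin n ⊕ Fin (4 * n)) where
  toFun
    | .tsq => .inl (.inl ())
    | .xsq => .inl (.inr ())
    | .vt p => .inr (.inl p)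
    | .vx p => .inr (.inr (.inl p))
    | .tt p => .inr (.inr (.inr p))
  invFun
    | .inl (.inl _) => .tsq
    | .inl (.inr _) => .xsq
    | .inr (.inl p) => .vt p
    | .inr (.inr (.inl p)) => .vx p
    | .inr (.inr (.inr p)) => .tt p
  left_inv a := by cases a <;> rfl
  right_inv a := by rcases a with (_ | _) | _ | _ | _ <;> rfl

instance inst_s10 (n : ℕ) : Finite (Gad n) := Finite.of_equiv _ (gadEquiv n).symm

open Classical in
theorem Set.ncard_eq_sum_ite {α : Type*} [Fintype α] (A : Set α) :
    A.ncard = ∑ a, if a ∈ A then 1 else 0 := by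
  simp [Set.ncard_eq_toFinset_card']

open Classical in
theorem ncard_sum_gad {V : Type*} [Fintype V] {n : ℕ} (A : Set (V ⊕ Gad n)) :
    A.ncard = {v | Sum.inl v ∈ A}.ncard + (if Sum.inr .tsq ∈ A then 1 else 0) +
      (if Sum.inr .xsq ∈ A then 1 else 0) + {p | Sum.inr (.vt p) ∈ A}.ncard +
      {p | Sum.inr (.vx p) ∈ A}.ncard + {p | Sum.inr (.tt p) ∈ A}.ncard := by
  have := Fintype.ofFinite (Gad n)
  simp only [Set.ncard_eq_sum_ite, Fintype.sum_sum_type, Set.mem_ofPred_eq]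
  rw [← (gadEquiv n).symm.sum_comp]
  simp only [gadEquiv, Fintype.sum_sum_type, Equiv.coe_fn_symm_mk, Fintype.sum_unique,
    add_assoc]
  congr!

section Degrees

variable {V : Type*} [Fintype V] (G : SimpleGraph V) (n : ℕ) (F : Set V) (x : V)
  (S : Set (V ⊕ Gad n))

open Classical in
theorem degIn_fromRel_grel_inl (v : V) :
    degIn (SimpleGraph.fromRel (grel G n F x)) S (Sum.inl v) =
      degIn G {u | Sum.inl u ∈ S} v + (if v = x ∧ Sum.inr .tsq ∈ S then 1 else 0) +
        (if v ∉ F ∧ Sum.inr .xsq ∈ S then 1 else 0) := by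
  have h : {u | v ≠ u ∧ (G.Adj v u ∨ G.Adj u v) ∧ Sum.inl u ∈ S} =
      G.neighborSet v ∩ {u | Sum.inl u ∈ S} := by
    ext u
    simp only [Set.mem_ofPred_eq, Set.mem_inter_iff, SimpleGraph.mem_neighborSet, G.adj_comm u v,
      or_self]
    exact ⟨fun h => h.2, fun h => ⟨h.1.ne, h⟩⟩
  rw [degIn, ncard_sum_gad, degIn, ← h]
  simp [grel, and_assoc]

open Classical in
theorem degIn_fromRel_grel_tsq :
    degIn (SimpleGraph.fromRel (grel G n F x)) S (Sum.inr .tsq) =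
      (if Sum.inl x ∈ S then 1 else 0) + {p | Sum.inr (.vt p) ∈ S}.ncard +
        {p | Sum.inr (.tt p) ∈ S}.ncard := by
  have h : {u : V | u = x ∧ (Sum.inl u : V ⊕ Gad n) ∈ S}.ncard =
      if Sum.inl x ∈ S then 1 else 0 := by
    split_ifs with hx
    · rw [← Set.ncard_singleton x]; congr 1; ext u; simp +contextual [hx]
    · rw [← Set.ncard_empty V]; congr 1; ext u; simp +contextual [hx]
  rw [degIn, ncard_sum_gad, ← h]
  simp [grel]

theorem degIn_fromRel_grel_xsq :
    degIn (SimpleGraph.fromRel (grel G n F x)) S (Sum.inr .xsq) =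
      {u | u ∉ F ∧ Sum.inl u ∈ S}.ncard + {p | Sum.inr (.vx p) ∈ S}.ncard +
        {p | Sum.inr (.tt p) ∈ S}.ncard := by
  rw [degIn, ncard_sum_gad]
  simp [grel]

end Degrees

theorem stmt10 {V : Type*} [Fintype V] (G : SimpleGraph V) (r : ℕ) (hr : 1 ≤ r)
    (Vsq : Set V) (x : V) (hx : x ∉ Vsq)
    (hdeg1 : ∀ v ∈ Vsq, (G.neighborSet v).ncard = 1 → ∃ w ∈ Vsq, G.Adj v w)
    (hdeg2 : ∀ v ∈ Vsq, 1 < (G.neighborSet v).ncard →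
      ∃ w ∈ Vsq, (G.neighborSet w).ncard = 1 ∧ G.Adj v w) :
    let n := Fintype.card V
    let F : Set V := {v | v ∈ Vsq ∧ (G.neighborSet v).ncard = 1}
    let G' : SimpleGraph (V ⊕ Gad n) := SimpleGraph.fromRel (grel G n F x)
    ((∃ R : Set V, IsStrongOffensiveAlliance G R ∧ 1 ≤ R.ncard ∧ R.ncard ≤ r ∧
        x ∈ R ∧ R ∩ Vsq = ∅) ↔
      (∃ R' : Set (V ⊕ Gad n), IsOffensiveAlliance G' R' ∧
        1 ≤ R'.ncard ∧ R'.ncard ≤ r + 4 * n ∧ R' ∩ VsqG' n Vsq = ∅)) := by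
  intro n F G'
  constructor
  · rintro ⟨R, ⟨-, hR⟩, -, hcard, hxR, hdisj⟩
    set R' : Set (V ⊕ Gad n) := Sum.inl '' R ∪ Tset n with hR'
    have hpos : 1 ≤ n := Fintype.card_pos_iff.2 ⟨x⟩
    have hcard' : R'.ncard = R.ncard + 4 * n := by
      rw [ncard_sum_gad]
      simp [hR', Tset, Set.ncard_univ]
    refine ⟨R', ⟨⟨Sum.inl x, by simp [hR', hxR]⟩, ?_⟩, by omega, by omega, ?_⟩
    · rintro (v | a) ⟨hv, u, hu, huv⟩
      · have hvR : v ∈ nbhd G R := by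
          refine ⟨by simpa [hR', Tset] using hv, ?_⟩
          rcases hu with ⟨w, hw, rfl⟩ | ⟨p, rfl⟩
          · refine ⟨w, hw, ?_⟩
            simpa [G', grel, G.adj_comm v w, and_iff_right_of_imp SimpleGraph.Adj.ne] using huv
          · simp [G', grel] at huv
        have hvx : v ≠ x := fun h => hvR.1 (h ▸ hxR)
        have key := hR v hvR
        have e : {u : V | (Sum.inl u : V ⊕ Gad n) ∈ R'} = R := by ext; simp [hR', Tset]
        have e' : {u : V | (Sum.inl u : V ⊕ Gad n) ∈ R'ᶜ} = Rᶜ := by ext; simp [hR', Tset]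
        rw [degIn_fromRel_grel_inl, degIn_fromRel_grel_inl, e, e']
        simp only [hvx, false_and, if_false]
        split_ifs <;> omega
      · cases a with
        | tsq =>
          rw [degIn_fromRel_grel_tsq, degIn_fromRel_grel_tsq]
          simp [hR', Tset, hxR, Set.ncard_univ]
        | xsq =>
          rw [degIn_fromRel_grel_xsq, degIn_fromRel_grel_xsq]
          have hle : {u : V | u ∉ F ∧ (Sum.inl u : V ⊕ Gad n) ∈ R'ᶜ}.ncard ≤ n :=
            (Set.ncard_le_card _).trans_eq Nat.card_eq_fintype_card
          have e1 : {p : Fin n | (Sum.inr (.vx p) : V ⊕ Gad n) ∈ R'ᶜ}.ncard ≤ n :=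
            (Set.ncard_le_card _).trans_eq (by simp)
          have e2 : {p : Fin (4 * n) | (Sum.inr (.tt p) : V ⊕ Gad n) ∈ R'ᶜ}.ncard = 0 := by
            simp [hR', Tset]
          have e3 : {p : Fin (4 * n) | (Sum.inr (.tt p) : V ⊕ Gad n) ∈ R'}.ncard = 4 * n := by
            simp [hR', Tset, Set.ncard_univ]
          omega
        | vt p => rcases hu with ⟨w, hw, rfl⟩ | ⟨q, rfl⟩ <;> simp [G', grel] at huv
        | vx p => rcases hu with ⟨w, hw, rfl⟩ | ⟨q, rfl⟩ <;> simp [G', grel] at huv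
        | tt p => exact (hv (Or.inr ⟨p, rfl⟩)).elim
    · have hRV : ∀ v ∈ R, v ∉ Vsq := fun v h h' =>
        Set.eq_empty_iff_forall_notMem.1 hdisj v ⟨h, h'⟩
      ext (v | a)
      · simpa [hR', Tset, VsqG'] using hRV v
      · cases a <;> simp [hR', Tset, VsqG']
  · rintro ⟨R', ⟨hne, hR'⟩, -, hcard, hdisj⟩
    have hout : ∀ w ∈ VsqG' n Vsq, w ∉ R' := fun w h h' =>
      Set.eq_empty_iff_forall_notMem.1 hdisj w ⟨h', h⟩
    have htsq : (Sum.inr .tsq : V ⊕ Gad n) ∉ R' := hout _ (by simp [VsqG'])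
    have hxsq : (Sum.inr .xsq : V ⊕ Gad n) ∉ R' := hout _ (by simp [VsqG'])
    have hvt : ∀ p, (Sum.inr (.vt p) : V ⊕ Gad n) ∉ R' := fun p => hout _ (by simp [VsqG'])
    have hvx : ∀ p, (Sum.inr (.vx p) : V ⊕ Gad n) ∉ R' := fun p => hout _ (by simp [VsqG'])
    have hV : ∀ v ∈ Vsq, (Sum.inl v : V ⊕ Gad n) ∉ R' := fun v hv => hout _ (by simp [VsqG', hv])
    have hT : ∃ p, (Sum.inr (.tt p) : V ⊕ Gad n) ∈ R' := by
      by_contra! hno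
      obtain ⟨(v | a), hw⟩ := hne
      · have hvF : v ∉ F := fun h => hV v h.1 hw
        have key := hR' (Sum.inr .xsq) ⟨hxsq, Sum.inl v, hw, by simp [G', grel, hvF]⟩
        rw [degIn_fromRel_grel_xsq, degIn_fromRel_grel_xsq] at key
        have hle : {u : V | u ∉ F ∧ (Sum.inl u : V ⊕ Gad n) ∈ R'}.ncard ≤ n :=
          (Set.ncard_le_card _).trans_eq Nat.card_eq_fintype_card
        simp [hvx, hno, Set.ncard_univ] at key
        omega
      · cases a <;> simp_all
    obtain ⟨p, hp⟩ := hT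
    have key := hR' (Sum.inr .tsq) ⟨htsq, _, hp, by simp [G', grel]⟩
    rw [degIn_fromRel_grel_tsq, degIn_fromRel_grel_tsq] at key
    have hle : {q : Fin (4 * n) | (Sum.inr (.tt q) : V ⊕ Gad n) ∈ R'}.ncard ≤ 4 * n :=
      (Set.ncard_le_card _).trans_eq (by simp)
    simp only [Set.mem_compl_iff, hvt, not_false_eq_true, Set.ofPred_true, Set.ncard_univ,
      Nat.card_eq_fintype_card, Fintype.card_fin, Set.ofPred_false, Set.ncard_empty] at key
    have hxR : (Sum.inl x : V ⊕ Gad n) ∈ R' := by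
      by_contra h
      simp only [h, if_false] at key
      omega
    simp only [hxR, if_true] at key
    have hsum := ncard_sum_gad R'
    refine ⟨{v | Sum.inl v ∈ R'}, ⟨⟨x, hxR⟩, ?_⟩, (Set.ncard_pos).2 ⟨x, hxR⟩, by omega, hxR, ?_⟩
    · rintro v ⟨hv, u, hu, huv⟩
      have hvF : v ∉ F := by
        rintro ⟨hvV, hv1⟩
        obtain ⟨w, hw, hvw⟩ := hdeg1 v hvV hv1
        obtain ⟨z, hz⟩ := Set.ncard_eq_one.1 hv1
        have hwz : w = z := by simpa [hz] using (show w ∈ G.neighborSet v from hvw)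
        have huz : u = z := by simpa [hz] using (show u ∈ G.neighborSet v from huv.symm)
        exact hV w hw (hwz ▸ huz ▸ hu)
      have key := hR' (Sum.inl v) ⟨hv, Sum.inl u, hu, by simp [G', grel, huv, huv.ne]⟩
      have e : {u : V | (Sum.inl u : V ⊕ Gad n) ∈ R'ᶜ} = {u : V | (Sum.inl u : V ⊕ Gad n) ∈ R'}ᶜ :=
        rfl
      rw [degIn_fromRel_grel_inl, degIn_fromRel_grel_inl, e] at key
      simp only [hvF, htsq, hxsq, Set.mem_compl_iff, not_false_eq_true, and_self, and_false,
        if_true, if_false] at key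
      omega
    · ext v
      simpa using fun h h' => hV v h' h
end

section
/- Every offensive alliance R of G with R ∩ V_□ = ∅ is also an offensive alliance of G'. -/
/-- The non-root vertices of the tree `T_u` attached to a degree-one forbidden vertex:
`4r` children of the root and `4r` grandchildren below each child. -/
inductive TNode (r : ℕ) : Type where
  | child (j : Fin (4 * r)) : TNode r
  | grand (j : Fin (4 * r)) (m : Fin (4 * r)) : TNode r

/-- One direction of each edge of `G'`: the edges of `G` together with, for each
degree-one forbidden vertex `u ∈ F`, the edges of the attached tree `T_u`. -/
def trel {V : Type*} (G : SimpleGraph V) (r : ℕ) (F : Set V) :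
    V ⊕ (↥F × TNode r) → V ⊕ (↥F × TNode r) → Prop
  | Sum.inl a, Sum.inl b => G.Adj a b
  | Sum.inl v, Sum.inr (u, TNode.child _) => v = u.val
  | Sum.inr (u, TNode.child j), Sum.inr (u', TNode.grand j' _) => u = u' ∧ j = j'
  | _, _ => False

theorem neighborSet_fromRel_trel_inl {V : Type*} (G : SimpleGraph V) (r : ℕ) (F : Set V)
    {v : V} (hv : v ∉ F) :
    (SimpleGraph.fromRel (trel G r F)).neighborSet (Sum.inl v) =
      Sum.inl '' G.neighborSet v := by
  ext x
  rcases x with b | ⟨u, _ | _⟩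
  · simp only [SimpleGraph.mem_neighborSet, SimpleGraph.fromRel_adj, trel, Set.mem_image,
      Sum.inl.injEq, exists_eq_right, G.adj_comm b v, or_self, ne_eq]
    exact ⟨fun h => h.2, fun h => ⟨h.ne, h⟩⟩
  · simp only [SimpleGraph.mem_neighborSet, SimpleGraph.fromRel_adj, trel, Set.mem_image,
      or_false, reduceCtorEq, and_false, exists_false, iff_false, not_and]
    rintro - rfl
    exact hv u.2
  · simp [trel]

theorem degIn_fromRel_trel_inl {V : Type*} (G : SimpleGraph V) (r : ℕ) (F R : Set V)
    {v : V} (hv : v ∉ F) :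
    degIn (SimpleGraph.fromRel (trel G r F)) (Sum.inl '' R) (Sum.inl v) = degIn G R v := by
  rw [degIn, degIn, neighborSet_fromRel_trel_inl G r F hv,
    ← Set.image_inter Sum.inl_injective, Set.ncard_image_of_injective _ Sum.inl_injective]

theorem degIn_compl_fromRel_trel_inl {V : Type*} (G : SimpleGraph V) (r : ℕ) (F R : Set V)
    {v : V} (hv : v ∉ F) :
    degIn (SimpleGraph.fromRel (trel G r F)) (Sum.inl '' R)ᶜ (Sum.inl v) = degIn G Rᶜ v := by
  rw [degIn, degIn, neighborSet_fromRel_trel_inl G r F hv, ← Set.sdiff_eq, ← Set.sdiff_eq,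
    ← Set.image_sdiff Sum.inl_injective, Set.ncard_image_of_injective _ Sum.inl_injective]

theorem stmt11 {V : Type*} [Fintype V] (G : SimpleGraph V) (r : ℕ) (hr : 1 ≤ r)
    (Vsq : Set V)
    (hdeg1 : ∀ v ∈ Vsq, (G.neighborSet v).ncard = 1 → ∃ w ∈ Vsq, G.Adj v w)
    (hdeg2 : ∀ v ∈ Vsq, 1 < (G.neighborSet v).ncard →
      ∃ w ∈ Vsq, (G.neighborSet w).ncard = 1 ∧ G.Adj v w) :
    let F : Set V := {v | v ∈ Vsq ∧ (G.neighborSet v).ncard = 1}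
    let G' : SimpleGraph (V ⊕ (↥F × TNode r)) := SimpleGraph.fromRel (trel G r F)
    ∀ R : Set V, IsOffensiveAlliance G R → R ∩ Vsq = ∅ →
      IsOffensiveAlliance G' (Sum.inl '' R) := by
  intro F G' R hR hdisj
  have hRV : ∀ w ∈ R, w ∉ Vsq := fun w hw hw' =>
    Set.eq_empty_iff_forall_notMem.mp hdisj w ⟨hw, hw'⟩
  refine ⟨hR.1.image _, ?_⟩
  rintro x ⟨hxR, _, ⟨u, hu, rfl⟩, hadj⟩
  have huF : u ∉ F := fun h => hRV u hu h.1
  have hmem : x ∈ G'.neighborSet (Sum.inl u) := hadj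
  rw [neighborSet_fromRel_trel_inl G r F huF] at hmem
  obtain ⟨v, huv, rfl⟩ := hmem
  have hvF : v ∉ F := by
    rintro ⟨hvV, hcard⟩
    obtain ⟨w, hw, hvw⟩ := hdeg1 v hvV hcard
    obtain ⟨a, ha⟩ := Set.ncard_eq_one.mp hcard
    have hua : u ∈ G.neighborSet v := SimpleGraph.Adj.symm huv
    have hwa : w ∈ G.neighborSet v := hvw
    rw [ha, Set.mem_singleton_iff] at hua hwa
    exact hRV u hu (hua.trans hwa.symm ▸ hw)
  rw [degIn_fromRel_trel_inl G r F R hvF, degIn_compl_fromRel_trel_inl G r F R hvF]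
  exact hR.2 v ⟨fun h => hxR ⟨v, h, rfl⟩, u, hu, huv⟩
end
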